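/- arXiv:2506.08308 — 5 statements merged into one kernel-verified Lean document; each statement's English description precedes it below -/
import Mathlib

section
/- Let n ≥ 1, let A, B ∈ M_n(ℂ) with A Hermitian (Aᴴ = A) and B symmetric (Bᵀ = B), and suppose ω ∈ ℂ and u, v ∈ ℂⁿ satisfy A u + B v = ω u and -conj(B) u - conj(A) v = ω v. If the normalization constraint Σᵢ |uᵢ|² - Σᵢ |vᵢ|² = 1 holds, then ω is real (its imaginary part is zero). -/
open Matrix

/-- Moving a matrix across the sesquilinear form `star x ⬝ᵥ y`. -/
theorem star_star_dotProduct_mulVec {n : Type*} [Fintype n] (M : Matrix n n ℂ) (x y : n → ℂ) :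
    star (star x ⬝ᵥ M *ᵥ y) = star y ⬝ᵥ Mᴴ *ᵥ x := by
  rw [Matrix.star_dotProduct, star_star, Matrix.star_mulVec, Matrix.dotProduct_mulVec]

/-- The form `star x ⬝ᵥ x` is the sum of squared norms. -/
theorem star_dotProduct_self_eq_sum_norm_sq {n : Type*} [Fintype n] (x : n → ℂ) :
    star x ⬝ᵥ x = ((∑ i, ‖x i‖ ^ 2 : ℝ) : ℂ) := by
  simp [dotProduct, Complex.conj_mul']

/-- If `(u, v)` is an eigenvector of the BdG block matrix `[[A, B], [-conj B, -conj A]]`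
(`A` Hermitian, `B` symmetric) with eigenvalue `ω`, and the normalization constraint
`∑ |uᵢ|² - ∑ |vᵢ|² = 1` holds, then `ω` is real. -/
theorem stmt1 (n : ℕ) (hn : 1 ≤ n) (A B : Matrix (Fin n) (Fin n) ℂ)
    (hA : Aᴴ = A) (hB : Bᵀ = B) (ω : ℂ) (u v : Fin n → ℂ)
    (h1 : A.mulVec u + B.mulVec v = ω • u)
    (h2 : -((B.map (starRingEnd ℂ)).mulVec u) - (A.map (starRingEnd ℂ)).mulVec v = ω • v)
    (hnorm : (∑ i, ‖u i‖ ^ 2) - (∑ i, ‖v i‖ ^ 2) = 1) :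
    ω.im = 0 := by
  have hAc : (A.map (starRingEnd ℂ))ᴴ = A.map (starRingEnd ℂ) := by
    ext i j
    simpa using congrArg star (congrFun₂ hA i j)
  have hBc : Bᴴ = B.map (starRingEnd ℂ) := by
    ext i j
    simpa using congrArg star (congrFun₂ hB i j)
  have hBcc : (B.map (starRingEnd ℂ))ᴴ = B := by
    rw [← hBc, conjTranspose_conjTranspose]
  have hu := congrArg (star u ⬝ᵥ ·) h1
  have hv := congrArg (star v ⬝ᵥ ·) h2
  simp only [dotProduct_add, dotProduct_sub, dotProduct_neg, dotProduct_smul, smul_eq_mul,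
    star_dotProduct_self_eq_sum_norm_sq] at hu hv
  have hnormC : ((∑ i, ‖u i‖ ^ 2 : ℝ) : ℂ) - ((∑ i, ‖v i‖ ^ 2 : ℝ) : ℂ) = 1 := by
    exact_mod_cast hnorm
  have hω : ω = star u ⬝ᵥ A *ᵥ u + star u ⬝ᵥ B *ᵥ v
      + (star v ⬝ᵥ B.map (starRingEnd ℂ) *ᵥ u + star v ⬝ᵥ A.map (starRingEnd ℂ) *ᵥ v) := by
    linear_combination hv - hu - ω * hnormC
  refine Complex.conj_eq_iff_im.mp ?_
  change star ω = ω
  rw [hω]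
  simp only [star_add, star_star_dotProduct_mulVec, hA, hAc, hBc, hBcc]
  ring
end

section
/- Let E be a complex inner product space and let H₊, H₋ : E → E be symmetric linear maps. Suppose ω₁, ω₂ ∈ ℝ and f₁, g₁, f₂, g₂ ∈ E satisfy the linear-response eigen-equations H₋ gᵢ = ωᵢ fᵢ and H₊ fᵢ = ωᵢ gᵢ for i = 1, 2. If |ω₁| ≠ |ω₂|, then ⟨f₁, g₂⟩ = 0 and ⟨f₂, g₁⟩ = 0 (biorthogonality of the eigenspaces). -/
open scoped ComplexInnerProductSpace

/-- Biorthogonality: eigenpairs of the linear-response system `H₋ g = ω f`, `H₊ f = ω g`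
(with `H₊`, `H₋` symmetric) whose eigenvalues have different magnitudes are biorthogonal. -/
theorem stmt2 {E : Type*} [NormedAddCommGroup E] [InnerProductSpace ℂ E]
    (Hp Hm : E →ₗ[ℂ] E)
    (hHp : ∀ x y : E, ⟪Hp x, y⟫ = ⟪x, Hp y⟫)
    (hHm : ∀ x y : E, ⟪Hm x, y⟫ = ⟪x, Hm y⟫)
    (ω₁ ω₂ : ℝ) (f₁ g₁ f₂ g₂ : E)
    (h1m : Hm g₁ = (ω₁ : ℂ) • f₁) (h1p : Hp f₁ = (ω₁ : ℂ) • g₁)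
    (h2m : Hm g₂ = (ω₂ : ℂ) • f₂) (h2p : Hp f₂ = (ω₂ : ℂ) • g₂)
    (hω : |ω₁| ≠ |ω₂|) :
    ⟪f₁, g₂⟫ = 0 ∧ ⟪f₂, g₁⟫ = 0 := by
  have hp : (ω₁ : ℂ) * ⟪g₁, f₂⟫ = ω₂ * ⟪f₁, g₂⟫ := by
    simpa [h1p, h2p, inner_smul_left, inner_smul_right] using hHp f₁ f₂
  have hm : (ω₁ : ℂ) * ⟪f₁, g₂⟫ = ω₂ * ⟪g₁, f₂⟫ := by
    simpa [h1m, h2m, inner_smul_left, inner_smul_right] using hHm g₁ g₂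
  have hsq : (ω₁ : ℂ) ^ 2 - (ω₂ : ℂ) ^ 2 ≠ 0 := by
    rw [sub_ne_zero]
    exact_mod_cast mt (sq_eq_sq_iff_abs_eq_abs ω₁ ω₂).mp hω
  refine ⟨(mul_eq_zero.mp ?_).resolve_left hsq,
    inner_eq_zero_symm.mp ((mul_eq_zero.mp ?_).resolve_left hsq)⟩
  · linear_combination (ω₁ : ℂ) * hm + (ω₂ : ℂ) * hp
  · linear_combination (ω₁ : ℂ) * hp + (ω₂ : ℂ) * hm
end

section
/- Let E be a complex inner product space, let H₊ be a symmetric positive-semidefinite linear map on E and H₋ a symmetric linear map on E. Let Φ₁, Φ₂ ∈ E be nonzero with ⟨Φ₁, Φ₂⟩ = 0, ker H₋ = span{Φ₁, Φ₂}, ker H₊ = span{Φ₂}, and suppose Φ̂₁ ∈ E satisfies H₊ Φ̂₁ = Φ₁. Let H(f, g) = (H₋ g, H₊ f) on E × E. Then ker(H²) = ker(H) ⊕ span{(Φ̂₁, 0)} (an internal direct sum, with (Φ̂₁, 0) ∉ ker H) and ker(H³) = ker(H²). -/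
open scoped ComplexInnerProductSpace

/-- The linear-response operator `H(f, g) = (H₋ g, H₊ f)` on `E × E`. -/
def lrOp {E : Type*} [AddCommGroup E] [Module ℂ E] (Hp Hm : E →ₗ[ℂ] E) :
    (E × E) →ₗ[ℂ] (E × E) :=
  LinearMap.prod (Hm ∘ₗ LinearMap.snd ℂ E E) (Hp ∘ₗ LinearMap.fst ℂ E E)

/-- A symmetric positive-semidefinite map kills every vector on which its quadratic form
vanishes. -/
theorem apply_eq_zero_of_re_inner_apply_self_eq_zero {E : Type*} [NormedAddCommGroup E]
    [InnerProductSpace ℂ E] {T : E →ₗ[ℂ] E} (hsym : ∀ x y : E, ⟪T x, y⟫ = ⟪x, T y⟫)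
    (hpos : ∀ x : E, 0 ≤ (⟪T x, x⟫).re) {u : E} (hu : (⟪T u, u⟫).re = 0) : T u = 0 := by
  by_contra h
  have hn : 0 < ‖T u‖ ^ 2 := by positivity
  have hc := hpos (T u)
  have key (t : ℝ) : 0 ≤ 2 * t * ‖T u‖ ^ 2 + t ^ 2 * (⟪T (T u), T u⟫).re := by
    have h2 : (⟪T u, T u⟫).re = ‖T u‖ ^ 2 := inner_self_eq_norm_sq (𝕜 := ℂ) (T u)
    have h3 := hpos (u + (t : ℂ) • T u)
    simp only [map_add, map_smul, inner_add_left, inner_add_right, inner_smul_left,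
      inner_smul_right, Complex.conj_ofReal, Complex.add_re, Complex.re_ofReal_mul,
      hsym (T u) u, hu, h2] at h3
    linarith
  generalize (⟪T (T u), T u⟫).re = c at *
  generalize ‖T u‖ ^ 2 = n at *
  have h4 := key (-(n / (c + 1)))
  have h5 : 2 * -(n / (c + 1)) * n + (-(n / (c + 1))) ^ 2 * c
      = -(n ^ 2 * (c + 2) / (c + 1) ^ 2) := by
    field_simp
    ring
  have h6 : 0 < n ^ 2 * (c + 2) / (c + 1) ^ 2 := by positivity
  linarith

/-- A vector in the range of a symmetric map has no component along a vector of its kernel. -/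
theorem coeff_eq_zero_of_apply_eq_add_smul {E : Type*} [NormedAddCommGroup E]
    [InnerProductSpace ℂ E] {T : E →ₗ[ℂ] E} (hsym : ∀ x y : E, ⟪T x, y⟫ = ⟪x, T y⟫)
    {x v w : E} {b : ℂ} (hw : w ≠ 0) (hTw : T w = 0) (hvw : ⟪v, w⟫ = 0)
    (hx : T x = v + b • w) : b = 0 := by
  have h := hsym x w
  rw [hx, hTw, inner_add_left, hvw, inner_smul_left] at h
  simpa [hw] using h

/-- Generalized nullspace of the BdG operator in the ferromagnetic case:
`ker H² = ker H ⊕ span{(Φ̂₁, 0)}` (internal direct sum) and `ker H³ = ker H²`. -/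
theorem stmt6 {E : Type*} [NormedAddCommGroup E] [InnerProductSpace ℂ E]
    (Hp Hm : E →ₗ[ℂ] E)
    (hpsym : ∀ x y : E, ⟪Hp x, y⟫ = ⟪x, Hp y⟫)
    (hppos : ∀ x : E, 0 ≤ (⟪Hp x, x⟫).re)
    (hmsym : ∀ x y : E, ⟪Hm x, y⟫ = ⟪x, Hm y⟫)
    (Φ₁ Φ₂ Φhat₁ : E) (hΦ₁ : Φ₁ ≠ 0) (hΦ₂ : Φ₂ ≠ 0) (horth : ⟪Φ₁, Φ₂⟫ = 0)
    (hkerm : LinearMap.ker Hm = Submodule.span ℂ {Φ₁, Φ₂})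
    (hkerp : LinearMap.ker Hp = Submodule.span ℂ {Φ₂})
    (hhat : Hp Φhat₁ = Φ₁) :
    LinearMap.ker (lrOp Hp Hm ∘ₗ lrOp Hp Hm) =
        LinearMap.ker (lrOp Hp Hm) ⊔ Submodule.span ℂ {(Φhat₁, (0 : E))} ∧
      Disjoint (LinearMap.ker (lrOp Hp Hm)) (Submodule.span ℂ {(Φhat₁, (0 : E))}) ∧
      (Φhat₁, (0 : E)) ∉ LinearMap.ker (lrOp Hp Hm) ∧
      LinearMap.ker (lrOp Hp Hm ∘ₗ lrOp Hp Hm ∘ₗ lrOp Hp Hm) =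
        LinearMap.ker (lrOp Hp Hm ∘ₗ lrOp Hp Hm) := by
  have hH (p : E × E) : lrOp Hp Hm p = (Hm p.2, Hp p.1) := rfl
  have hm (x : E) : Hm x = 0 ↔ ∃ a b : ℂ, a • Φ₁ + b • Φ₂ = x := by
    rw [← LinearMap.mem_ker, hkerm, Submodule.mem_span_pair]
  have hp (x : E) : Hp x = 0 ↔ ∃ b : ℂ, b • Φ₂ = x := by
    rw [← LinearMap.mem_ker, hkerp, Submodule.mem_span_singleton]
  have hm₁ : Hm Φ₁ = 0 := (hm _).2 ⟨1, 0, by simp⟩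
  have hm₂ : Hm Φ₂ = 0 := (hm _).2 ⟨0, 1, by simp⟩
  have hp₂ : Hp Φ₂ = 0 := (hp _).2 ⟨1, by simp⟩
  have hpm (x : E) (hx : Hp (Hm x) = 0) : Hm x = 0 := by
    obtain ⟨b, hb⟩ := (hp _).1 hx
    have hb0 : b = 0 := coeff_eq_zero_of_apply_eq_add_smul hmsym (x := x) hΦ₂ hm₂
      (inner_zero_left _) (by rw [hb, zero_add])
    rw [← hb, hb0, zero_smul]
  have hmp (x : E) (hx : Hm (Hp x) = 0) : ∃ a : ℂ, Hp x = a • Φ₁ := by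
    obtain ⟨a, b, hab⟩ := (hm _).1 hx
    have hb0 : b = 0 := coeff_eq_zero_of_apply_eq_add_smul hpsym (x := x) hΦ₂ hp₂
      (by rw [inner_smul_left, horth, mul_zero]) hab.symm
    exact ⟨a, by rw [← hab, hb0, zero_smul, add_zero]⟩
  have hnotMem : (Φhat₁, (0 : E)) ∉ LinearMap.ker (lrOp Hp Hm) := by
    simpa [hH, hhat] using hΦ₁
  refine ⟨le_antisymm ?_ (sup_le (LinearMap.ker_le_ker_comp _ _) ?_), ?_, hnotMem,
    le_antisymm ?_ ?_⟩
  · rintro ⟨f, g⟩ hfg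
    simp only [LinearMap.mem_ker, LinearMap.comp_apply, hH, Prod.mk_eq_zero] at hfg
    obtain ⟨a, ha⟩ := hmp f hfg.1
    refine Submodule.mem_sup.2 ⟨(f - a • Φhat₁, g), ?_, a • (Φhat₁, 0),
      Submodule.smul_mem _ _ (Submodule.mem_span_singleton_self _), by simp⟩
    simp [hH, hpm g hfg.2, ha, hhat]
  · rw [Submodule.span_singleton_le_iff_mem]
    simp [hH, hhat, hm₁]
  · exact Submodule.disjoint_span_singleton.2 fun h => absurd h hnotMem
  · rintro ⟨f, g⟩ hfg
    simp only [LinearMap.mem_ker, LinearMap.comp_apply, hH, Prod.mk_eq_zero] at hfg ⊢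
    refine ⟨hpm _ hfg.2, ?_⟩
    obtain ⟨a, ha⟩ := hmp _ hfg.1
    refine apply_eq_zero_of_re_inner_apply_self_eq_zero hpsym hppos ?_
    rw [ha, inner_smul_left, ← hmsym, hm₁, inner_zero_left, mul_zero, Complex.zero_re]
  · rw [← LinearMap.comp_assoc, LinearMap.comp_assoc]
    exact LinearMap.ker_le_ker_comp _ _
end

section
/- Let E be a complex inner product space, let H₋ be a symmetric linear map on E and H₊ a symmetric positive-semidefinite linear map on E. Suppose Φ₁ ∈ E is nonzero with H₋ Φ₁ = 0, and Φ̂₁ ∈ E satisfies H₊ Φ̂₁ = Φ₁. Then Φ̂₁ is not in the range of H₋, i.e., there is no g ∈ E with H₋ g = Φ̂₁. -/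
open scoped ComplexInnerProductSpace

/-- A symmetric positive semidefinite map annihilates every vector on which its quadratic form
vanishes. -/
theorem LinearMap.IsSymmetric.apply_eq_zero_of_re_inner_self_eq_zero {E : Type*}
    [NormedAddCommGroup E] [InnerProductSpace ℂ E] {T : E →ₗ[ℂ] E} (hT : T.IsSymmetric)
    (hpos : ∀ x : E, 0 ≤ (⟪T x, x⟫).re) {x : E} (hx : (⟪T x, x⟫).re = 0) : T x = 0 := by
  have hquad (t : ℝ) :
      0 ≤ (⟪T (T x), T x⟫).re * (t * t) + 2 * ‖T x‖ ^ 2 * t + 0 := by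
    have hcross : ⟪T (T x), x⟫ = ⟪T x, T x⟫ := hT (T x) x
    have hnorm : (⟪T x, T x⟫).re = ‖T x‖ ^ 2 := inner_self_eq_norm_sq (𝕜 := ℂ) (T x)
    have h := hpos (x + (t : ℂ) • T x)
    simp only [map_add, map_smul, inner_add_left, inner_add_right, inner_smul_left,
      inner_smul_right, Complex.conj_ofReal, Complex.add_re, Complex.re_ofReal_mul, hcross,
      hnorm, hx] at h
    linarith
  have hdisc := discrim_le_zero hquad
  have hsq : ‖T x‖ ^ 2 = 0 := by
    rw [discrim] at hdisc
    nlinarith [sq_nonneg (‖T x‖ ^ 2)]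
  simpa using hsq

/-- If `H₋` is symmetric, `H₊` is symmetric positive semidefinite, `Φ₁ ≠ 0` with
`H₋ Φ₁ = 0`, and `H₊ Φ̂₁ = Φ₁`, then `Φ̂₁` is not in the range of `H₋`. -/
theorem stmt12 {E : Type*} [NormedAddCommGroup E] [InnerProductSpace ℂ E]
    (Hp Hm : E →ₗ[ℂ] E)
    (hmsym : ∀ x y : E, ⟪Hm x, y⟫ = ⟪x, Hm y⟫)
    (hpsym : ∀ x y : E, ⟪Hp x, y⟫ = ⟪x, Hp y⟫)
    (hppos : ∀ x : E, 0 ≤ (⟪Hp x, x⟫).re)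
    (Φ₁ Φhat₁ : E) (hΦ₁ : Φ₁ ≠ 0) (hker : Hm Φ₁ = 0) (hhat : Hp Φhat₁ = Φ₁) :
    ¬∃ g : E, Hm g = Φhat₁ := by
  rintro ⟨g, rfl⟩
  have hzero : ⟪Hp (Hm g), Hm g⟫ = 0 := by
    rw [hhat, ← hmsym, hker, inner_zero_left]
  have hsym : Hp.IsSymmetric := hpsym
  exact hΦ₁ (hhat ▸ hsym.apply_eq_zero_of_re_inner_self_eq_zero hppos (by simp [hzero]))
end

section
/- Let E be a finite-dimensional complex inner product space, let H₊ be a symmetric positive-definite (hence invertible) linear map on E, let H₋ be a symmetric linear map on E, and let Φ₁, Φ₂ ∈ E be linearly independent with ker H₋ = span{Φ₁, Φ₂} and ker H₊ = {0}. Let H(f, g) = (H₋ g, H₊ f) on E × E and set Φ̂ⱼ = H₊⁻¹ Φⱼ for j = 1, 2. Then ker H = span{(0, Φ₁), (0, Φ₂)}, ker(H²) = ker(H) ⊕ span{(Φ̂₁, 0), (Φ̂₂, 0)} (an internal direct sum), and ker(H³) = ker(H²). -/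
open scoped ComplexInnerProductSpace

theorem lrOp_apply {E : Type*} [AddCommGroup E] [Module ℂ E] (Hp Hm : E →ₗ[ℂ] E) (x : E × E) :
    lrOp Hp Hm x = (Hm x.2, Hp x.1) := rfl

/-- If `A` is positive definite and `B` is symmetric, then `B A B x = 0` forces `B x = 0`. -/
theorem apply_eq_zero_of_symmetric_of_posDef {E : Type*} [NormedAddCommGroup E]
    [InnerProductSpace ℂ E] {A B : E →ₗ[ℂ] E} (hA : ∀ x : E, x ≠ 0 → 0 < (⟪A x, x⟫).re)
    (hB : ∀ x y : E, ⟪B x, y⟫ = ⟪x, B y⟫) {x : E} (hx : B (A (B x)) = 0) : B x = 0 := by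
  by_contra h
  have hpos := hA _ h
  rw [← hB, hx, inner_zero_left] at hpos
  exact lt_irrefl _ hpos

/-- Generalized nullspace of the BdG operator in the antiferromagnetic case:
with `H₊` symmetric positive definite (hence invertible, `Φ̂ⱼ = H₊⁻¹ Φⱼ`), `H₋` symmetric,
`ker H₋ = span{Φ₁, Φ₂}` with `Φ₁, Φ₂` linearly independent, and `ker H₊ = {0}`, one has
`ker H = span{(0,Φ₁), (0,Φ₂)}`, `ker H² = ker H ⊕ span{(Φ̂₁,0), (Φ̂₂,0)}` (internal direct
sum), and `ker H³ = ker H²`. -/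
theorem stmt13 {E : Type*} [NormedAddCommGroup E] [InnerProductSpace ℂ E]
    [FiniteDimensional ℂ E]
    (Hp Hm : E →ₗ[ℂ] E)
    (hpsym : ∀ x y : E, ⟪Hp x, y⟫ = ⟪x, Hp y⟫)
    (hppos : ∀ x : E, x ≠ 0 → 0 < (⟪Hp x, x⟫).re)
    (hmsym : ∀ x y : E, ⟪Hm x, y⟫ = ⟪x, Hm y⟫)
    (Φ₁ Φ₂ : E) (hind : LinearIndependent ℂ ![Φ₁, Φ₂])
    (hkerm : LinearMap.ker Hm = Submodule.span ℂ {Φ₁, Φ₂})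
    (hkerp : LinearMap.ker Hp = ⊥)
    (Φhat₁ Φhat₂ : E) (hhat₁ : Hp Φhat₁ = Φ₁) (hhat₂ : Hp Φhat₂ = Φ₂) :
    LinearMap.ker (lrOp Hp Hm) = Submodule.span ℂ {((0 : E), Φ₁), ((0 : E), Φ₂)} ∧
      LinearMap.ker (lrOp Hp Hm ∘ₗ lrOp Hp Hm) =
        LinearMap.ker (lrOp Hp Hm) ⊔
          Submodule.span ℂ {(Φhat₁, (0 : E)), (Φhat₂, (0 : E))} ∧
      Disjoint (LinearMap.ker (lrOp Hp Hm))
        (Submodule.span ℂ {(Φhat₁, (0 : E)), (Φhat₂, (0 : E))}) ∧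
      LinearMap.ker (lrOp Hp Hm ∘ₗ lrOp Hp Hm ∘ₗ lrOp Hp Hm) =
        LinearMap.ker (lrOp Hp Hm ∘ₗ lrOp Hp Hm) := by
  have hp : ∀ x, Hp x = 0 ↔ x = 0 := fun x => by
    rw [← LinearMap.mem_ker, hkerp, Submodule.mem_bot]
  have hm : ∀ x, Hm x = 0 ↔ ∃ a b : ℂ, a • Φ₁ + b • Φ₂ = x := fun x => by
    rw [← LinearMap.mem_ker, hkerm, Submodule.mem_span_pair]
  have hker : ∀ x, x ∈ LinearMap.ker (lrOp Hp Hm) ↔ x.1 = 0 ∧ Hm x.2 = 0 := fun x => by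
    simp [lrOp_apply, hp, and_comm]
  have hker_sq : ∀ x, x ∈ LinearMap.ker (lrOp Hp Hm ∘ₗ lrOp Hp Hm) ↔
      Hm (Hp x.1) = 0 ∧ Hm x.2 = 0 := fun x => by
    simp [lrOp_apply, hp]
  have hhat : ∀ x, x ∈ Submodule.span ℂ {(Φhat₁, (0 : E)), (Φhat₂, (0 : E))} ↔
      Hm (Hp x.1) = 0 ∧ x.2 = 0 := by
    rintro ⟨f, g⟩
    have hf : ∀ a b : ℂ, a • Φhat₁ + b • Φhat₂ = f ↔ a • Φ₁ + b • Φ₂ = Hp f := fun a b => by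
      rw [← (LinearMap.ker_eq_bot.mp hkerp).eq_iff]
      simp [hhat₁, hhat₂]
    simp [Submodule.mem_span_pair, hm, hf, eq_comm (a := g)]
  refine ⟨?_, ?_, ?_, ?_⟩
  · ext ⟨f, g⟩
    rw [hker, hm, Submodule.mem_span_pair]
    simp [eq_comm (a := f)]
  · ext ⟨f, g⟩
    rw [hker_sq, Submodule.mem_sup]
    constructor
    · rintro ⟨hf, hg⟩
      exact ⟨(0, g), (hker _).mpr ⟨rfl, hg⟩, (f, 0), (hhat _).mpr ⟨hf, rfl⟩, by simp⟩
    · rintro ⟨y, hy, z, hz, hyz⟩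
      obtain ⟨hy₁, hy₂⟩ := (hker y).mp hy
      obtain ⟨hz₁, hz₂⟩ := (hhat z).mp hz
      rw [← hyz]
      simp [hy₁, hy₂, hz₁, hz₂]
  · rw [Submodule.disjoint_def]
    intro x hx hx'
    exact Prod.ext ((hker x).mp hx).1 ((hhat x).mp hx').2
  · ext x
    rw [hker_sq]
    have hiff : Hm (Hp (Hm x.2)) = 0 ↔ Hm x.2 = 0 :=
      ⟨apply_eq_zero_of_symmetric_of_posDef hppos hmsym, fun h => by simp [h]⟩
    simp [lrOp_apply, hp, hiff, and_comm]
end
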